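/- Fix ω>0. There exist constants C'=C'(ω)>0 and N₀=N₀(ω) such that for all N≥N₀ the following holds: if λ_1 ≤ ⋯ ≤ λ_N are real numbers satisfying |λ_k − γ_k| ≤ N^{−2/3+ω}·k̂^{−1/3} for every k∈⟦1,N⟧, then for every ℓ∈⟦1,N⟧, Σ_{p : |p−ℓ| > N^{2ω}} 1/(λ_p − λ_ℓ)² ≤ C'·N^{4/3+2ω}·ℓ̂^{2/3}. -/

import Mathlib

open MeasureTheory

noncomputable section

/-- The semicircle density `ρ_sc(x) = √((4 - x²)₊) / (2π)`. -/
def semicircle (x : ℝ) : ℝ := Real.sqrt (max (4 - x ^ 2) 0) / (2 * Real.pi)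

/-- `γ` is the family of classical eigenvalue locations of the semicircle law:
`γ_i ∈ [-2, 2]` and `i / N = ∫_{-2}^{γ_i} ρ_sc(x) dx` (with `i` one-indexed). -/
def IsClassicalLoc (N : ℕ) (γ : Fin N → ℝ) : Prop :=
  ∀ i : Fin N, γ i ∈ Set.Icc (-2 : ℝ) 2 ∧
    ((i.1 : ℝ) + 1) / N = ∫ x in (-2 : ℝ)..(γ i), semicircle x

lemma continuous_semicircle : Continuous semicircle := by
  unfold semicircle
  fun_prop

lemma semicircle_nonneg (x : ℝ) : 0 ≤ semicircle x := by
  unfold semicircle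
  positivity

lemma semicircle_eq {x : ℝ} (hx : x ∈ Set.Icc (-2 : ℝ) 2) :
    semicircle x = √(4 - x ^ 2) / (2 * Real.pi) := by
  unfold semicircle
  rw [max_eq_left]
  nlinarith [hx.1, hx.2]

lemma integral_semicircle : ∫ x in (-2 : ℝ)..2, semicircle x = 1 := by
  have h : ∀ x : ℝ, x ∈ Set.uIcc (-1 : ℝ) 1 → semicircle (2 * x) = √(1 - x ^ 2) / Real.pi := by
    intro x hx
    rw [Set.uIcc_of_le (by norm_num)] at hx
    rw [semicircle_eq ⟨by linarith [hx.1], by linarith [hx.2]⟩,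
      show 4 - (2 * x) ^ 2 = 2 ^ 2 * (1 - x ^ 2) by ring, Real.sqrt_mul (by norm_num),
      Real.sqrt_sq (by norm_num)]
    field_simp
  have h2 := intervalIntegral.mul_integral_comp_mul_left (f := semicircle) (a := -1) (b := 1) 2
  rw [intervalIntegral.integral_congr h, intervalIntegral.integral_div,
    integral_sqrt_one_sub_sq] at h2
  norm_num at h2
  rw [← h2]
  field_simp

lemma hasDerivAt_semicircle_cube {x : ℝ} (hx : x ∈ Set.Ioo (-2 : ℝ) 2) :
    HasDerivAt (fun t => semicircle t ^ 3) (-(3 * x / (4 * Real.pi ^ 2)) * semicircle x) x := by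
  have hpos : 0 < 4 - x ^ 2 := by nlinarith [hx.1, hx.2]
  have hs : 0 < √(4 - x ^ 2) := Real.sqrt_pos.2 hpos
  have h0 : HasDerivAt (fun t : ℝ => 4 - t ^ 2) (-(2 * x)) x := by
    simpa using (hasDerivAt_pow 2 x).const_sub 4
  have h1 := ((h0.sqrt hpos.ne').div_const (2 * Real.pi)).fun_pow 3
  have h2 : (fun t => semicircle t ^ 3) =ᶠ[nhds x]
      fun t => (√(4 - t ^ 2) / (2 * Real.pi)) ^ 3 := by
    filter_upwards [Ioo_mem_nhds hx.1 hx.2] with t ht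
    rw [semicircle_eq (Set.Ioo_subset_Icc_self ht)]
  refine (h1.congr_of_eventuallyEq h2).congr_deriv ?_
  have hpi := Real.pi_ne_zero
  rw [semicircle_eq (Set.Ioo_subset_Icc_self hx)]
  push_cast
  field_simp
  ring

lemma abs_semicircle_cube_slope_le {x : ℝ} (hx : x ∈ Set.Ioo (-2 : ℝ) 2) :
    |3 * x / (4 * Real.pi ^ 2)| ≤ 1 := by
  have hpi := Real.pi_gt_three
  have h9 : 9 < Real.pi ^ 2 := by nlinarith
  rw [abs_div, abs_of_pos (show 0 < 4 * Real.pi ^ 2 by positivity), div_le_one (by positivity),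
    abs_le]
  constructor <;> linarith [hx.1, hx.2]

lemma hasDerivAt_integral_semicircle (x : ℝ) :
    HasDerivAt (fun t => ∫ s in (-2 : ℝ)..t, semicircle s) (semicircle x) x :=
  intervalIntegral.integral_hasDerivAt_right (continuous_semicircle.intervalIntegrable _ _)
    (continuous_semicircle.stronglyMeasurableAtFilter _ _) continuous_semicircle.continuousAt

lemma continuous_integral_semicircle :
    Continuous (fun t => ∫ s in (-2 : ℝ)..t, semicircle s) :=
  continuous_iff_continuousAt.2 fun x => (hasDerivAt_integral_semicircle x).continuousAt

lemma semicircle_endpoints : semicircle (-2) = 0 ∧ semicircle 2 = 0 := by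
  constructor <;> norm_num [semicircle]

/-- Near the left edge, the density is at most the cube root of the distribution function. -/
lemma semicircle_cube_le {x : ℝ} (hx : x ∈ Set.Icc (-2 : ℝ) 2) :
    semicircle x ^ 3 ≤ ∫ s in (-2 : ℝ)..x, semicircle s := by
  have hm : MonotoneOn (fun t => (∫ s in (-2 : ℝ)..t, semicircle s) - semicircle t ^ 3)
      (Set.Icc (-2 : ℝ) 2) := by
    refine monotoneOn_of_hasDerivWithinAt_nonneg (convex_Icc _ _)
      (f' := fun t => semicircle t - -(3 * t / (4 * Real.pi ^ 2)) * semicircle t)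
      (continuous_integral_semicircle.sub (continuous_semicircle.pow 3)).continuousOn ?_ ?_
    · intro t ht
      rw [interior_Icc] at ht
      exact ((hasDerivAt_integral_semicircle t).fun_sub
        (hasDerivAt_semicircle_cube ht)).hasDerivWithinAt
    · intro t ht
      rw [interior_Icc] at ht
      have := abs_le.1 (abs_semicircle_cube_slope_le ht)
      nlinarith [semicircle_nonneg t]
  have := hm (Set.left_mem_Icc.2 (by norm_num)) hx hx.1
  simp only [intervalIntegral.integral_same, semicircle_endpoints.1] at this
  linarith

/-- Near the right edge, the density is at most the cube root of the complementary
distribution function. -/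
lemma semicircle_cube_le_one_sub {x : ℝ} (hx : x ∈ Set.Icc (-2 : ℝ) 2) :
    semicircle x ^ 3 ≤ 1 - ∫ s in (-2 : ℝ)..x, semicircle s := by
  have hm : MonotoneOn (fun t => (∫ s in (-2 : ℝ)..t, semicircle s) + semicircle t ^ 3)
      (Set.Icc (-2 : ℝ) 2) := by
    refine monotoneOn_of_hasDerivWithinAt_nonneg (convex_Icc _ _)
      (f' := fun t => semicircle t + -(3 * t / (4 * Real.pi ^ 2)) * semicircle t)
      (continuous_integral_semicircle.add (continuous_semicircle.pow 3)).continuousOn ?_ ?_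
    · intro t ht
      rw [interior_Icc] at ht
      exact ((hasDerivAt_integral_semicircle t).fun_add
        (hasDerivAt_semicircle_cube ht)).hasDerivWithinAt
    · intro t ht
      rw [interior_Icc] at ht
      have := abs_le.1 (abs_semicircle_cube_slope_le ht)
      nlinarith [semicircle_nonneg t]
  have := hm hx (Set.right_mem_Icc.2 (by norm_num)) hx.2
  simp only [integral_semicircle, semicircle_endpoints.2] at this
  linarith

lemma integral_semicircle_mono : Monotone (fun t => ∫ s in (-2 : ℝ)..t, semicircle s) := by
  refine monotone_of_hasDerivAt_nonneg hasDerivAt_integral_semicircle semicircle_nonneg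

/-- A quantile gap of the semicircle law is at least its mass divided by the cube root of the
mass outside the gap on either side, counted together with the gap. -/
lemma IsClassicalLoc.sub_le_mul {N : ℕ} {γ : Fin N → ℝ} (hγ : IsClassicalLoc N γ) {i j : Fin N}
    (hij : i < j) {B : ℝ} (hB : 0 ≤ B)
    (hB3 : (min (j.1 + 1) (N - i.1) : ℝ) / N ≤ B ^ 3) :
    ((j.1 : ℝ) - i.1) / N ≤ (γ j - γ i) * B := by
  have hN : (0 : ℝ) < N := by exact_mod_cast i.pos
  have hlt : (i.1 : ℝ) < j.1 := by exact_mod_cast hij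
  obtain ⟨hi, hFi⟩ := hγ i
  obtain ⟨hj, hFj⟩ := hγ j
  have hle : γ i ≤ γ j := by
    by_contra! h
    have h1 := integral_semicircle_mono h.le
    simp only [← hFi, ← hFj] at h1
    rw [div_le_div_iff_of_pos_right hN] at h1
    linarith
  have hint : ∫ x in (γ i)..(γ j), semicircle x = ((j.1 : ℝ) - i.1) / N := by
    rw [← intervalIntegral.integral_interval_sub_left
      (continuous_semicircle.intervalIntegrable (-2) (γ j))
      (continuous_semicircle.intervalIntegrable (-2) (γ i)), ← hFi, ← hFj]
    ring
  have hbd : ∀ x ∈ Set.Icc (γ i) (γ j), semicircle x ≤ B := by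
    intro x hx
    have hx2 : x ∈ Set.Icc (-2 : ℝ) 2 := ⟨hi.1.trans hx.1, hx.2.trans hj.2⟩
    refine le_of_pow_le_pow_left₀ three_ne_zero hB (le_trans ?_ hB3)
    rw [le_div_iff₀ hN, le_min_iff, ← le_div_iff₀ hN, ← le_div_iff₀ hN]
    have h1 := integral_semicircle_mono hx.1
    have h2 := integral_semicircle_mono hx.2
    simp only [← hFi, ← hFj] at h1 h2
    refine ⟨(semicircle_cube_le hx2).trans h2, (semicircle_cube_le_one_sub hx2).trans ?_⟩
    have h3 : ((i.1 : ℝ) + 1) / N + (N - i.1) / N = 1 + 1 / N := by field_simp; ring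
    have h4 : 0 < 1 / (N : ℝ) := by positivity
    linarith
  rw [← hint]
  calc ∫ x in (γ i)..(γ j), semicircle x ≤ ∫ _ in (γ i)..(γ j), B :=
        intervalIntegral.integral_mono_on hle (continuous_semicircle.intervalIntegrable _ _)
          intervalIntegrable_const hbd
    _ = (γ j - γ i) * B := by simp

/-- Distance from the spectral edges of the index `k`, counted from one. -/
def edgeDist {N : ℕ} (k : Fin N) : ℝ := min ((k.1 : ℝ) + 1) (N - k.1)

lemma one_le_edgeDist {N : ℕ} (k : Fin N) : 1 ≤ edgeDist k := by
  have h : (k.1 : ℝ) + 1 ≤ N := by exact_mod_cast k.2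
  have h0 : (0 : ℝ) ≤ k.1 := by positivity
  exact le_min (by linarith) (by linarith)

/-- Distinct classical locations are separated by the expected amount. -/
lemma IsClassicalLoc.le_abs_sub {N : ℕ} {γ : Fin N → ℝ} (hγ : IsClassicalLoc N γ) {i j : Fin N}
    (hij : i ≠ j) {M : ℝ}
    (hi : edgeDist i + |(i.1 : ℝ) - j.1| ≤ M) (hj : edgeDist j + |(i.1 : ℝ) - j.1| ≤ M) :
    (N : ℝ) ^ (-(2 : ℝ) / 3) * |(i.1 : ℝ) - j.1| ≤ |γ i - γ j| * M ^ ((1 : ℝ) / 3) := by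
  wlog hlt : i < j generalizing i j
  · have := this hij.symm (by rwa [abs_sub_comm]) (by rwa [abs_sub_comm])
      (lt_of_le_of_ne (not_lt.1 hlt) hij.symm)
    rwa [abs_sub_comm, abs_sub_comm (γ i)]
  have hN : (0 : ℝ) < N := by exact_mod_cast i.pos
  have hltR : (i.1 : ℝ) < j.1 := by exact_mod_cast hlt
  have hM : 0 < M := by linarith [one_le_edgeDist i, abs_nonneg ((i.1 : ℝ) - j.1)]
  have hd : |(i.1 : ℝ) - j.1| = j.1 - i.1 := by rw [abs_of_neg (by linarith)]; ring
  rw [hd] at hi ⊢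
  have hmin : min ((j.1 : ℝ) + 1) (N - i.1) ≤ M := by
    refine le_trans ?_ hi
    rw [edgeDist, ← min_add_add_right]
    exact min_le_min (by linarith) (by linarith)
  have hcube : (M / N) ≤ ((M / N) ^ ((1 : ℝ) / 3)) ^ 3 := by
    rw [← Real.rpow_natCast, ← Real.rpow_mul (by positivity)]
    norm_num
  have h := hγ.sub_le_mul hlt (B := (M / N) ^ ((1 : ℝ) / 3)) (by positivity)
    (le_trans (by gcongr) hcube)
  rw [Real.div_rpow hM.le hN.le] at h
  have hsplit : (N : ℝ) ^ (-(2 : ℝ) / 3) = (N : ℝ) ^ ((1 : ℝ) / 3) / N := by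
    rw [← Real.rpow_sub_one hN.ne']
    norm_num
  have hn : 0 < (N : ℝ) ^ ((1 : ℝ) / 3) := by positivity
  calc (N : ℝ) ^ (-(2 : ℝ) / 3) * (j.1 - i.1)
      = (N : ℝ) ^ ((1 : ℝ) / 3) * (((j.1 : ℝ) - i.1) / N) := by rw [hsplit]; ring
    _ ≤ (N : ℝ) ^ ((1 : ℝ) / 3) *
        ((γ j - γ i) * (M ^ ((1 : ℝ) / 3) / (N : ℝ) ^ ((1 : ℝ) / 3))) := by gcongr
    _ = (γ j - γ i) * M ^ ((1 : ℝ) / 3) := by field_simp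
    _ ≤ |γ i - γ j| * M ^ ((1 : ℝ) / 3) := by
        rw [abs_sub_comm]
        gcongr
        exact le_abs_self _

lemma edgeDist_le_add {N : ℕ} (i j : Fin N) :
    edgeDist i ≤ edgeDist j + |(i.1 : ℝ) - j.1| := by
  have h1 := le_abs_self ((i.1 : ℝ) - j.1)
  have h2 := neg_abs_le ((i.1 : ℝ) - j.1)
  rw [edgeDist, edgeDist, ← min_add_add_right]
  exact min_le_min (by linarith) (by linarith)

/-- The rigidity error at distance `d` is a small fraction of the typical gap. -/
lemma rigidity_error_le {ω n d e M : ℝ} (hn : 0 < n) (he : 1 ≤ e)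
    (hbig : 12 ≤ n ^ (ω / 3)) (hd : 1 ≤ d) (hnd : n ^ (2 * ω) ≤ d)
    (hM0 : 0 ≤ M) (hM : M ≤ 3 * d * e) :
    4 * (n ^ (-(2 : ℝ) / 3 + ω) * e ^ (-(1 : ℝ) / 3)) * M ^ ((1 : ℝ) / 3)
      ≤ n ^ (-(2 : ℝ) / 3) * d := by
  have he0 : 0 < e := by linarith
  have hd0 : 0 < d := by linarith
  have h3 : (3 : ℝ) ^ ((1 : ℝ) / 3) ≤ 3 := by
    simpa using Real.rpow_le_rpow_of_exponent_le (x := 3) (by norm_num)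
      (show (1 : ℝ) / 3 ≤ 1 by norm_num)
  have hMr : M ^ ((1 : ℝ) / 3) ≤ 3 * d ^ ((1 : ℝ) / 3) * e ^ ((1 : ℝ) / 3) := by
    calc M ^ ((1 : ℝ) / 3) ≤ (3 * d * e) ^ ((1 : ℝ) / 3) := by gcongr
      _ = 3 ^ ((1 : ℝ) / 3) * d ^ ((1 : ℝ) / 3) * e ^ ((1 : ℝ) / 3) := by
        rw [Real.mul_rpow (by positivity) he0.le, Real.mul_rpow (by norm_num) hd0.le]
      _ ≤ _ := by gcongr
  have hcancel : e ^ (-(1 : ℝ) / 3) * e ^ ((1 : ℝ) / 3) = 1 := by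
    rw [← Real.rpow_add he0]
    norm_num
  have hpow : 12 * n ^ ω ≤ d ^ ((2 : ℝ) / 3) := by
    calc 12 * n ^ ω ≤ n ^ (ω / 3) * n ^ ω := by gcongr
      _ = (n ^ (2 * ω)) ^ ((2 : ℝ) / 3) := by
        rw [← Real.rpow_add hn, ← Real.rpow_mul hn.le]
        ring_nf
      _ ≤ d ^ ((2 : ℝ) / 3) := by gcongr
  have hdd : d ^ ((2 : ℝ) / 3) * d ^ ((1 : ℝ) / 3) = d := by
    rw [← Real.rpow_add hd0]
    norm_num
  calc 4 * (n ^ (-(2 : ℝ) / 3 + ω) * e ^ (-(1 : ℝ) / 3)) * M ^ ((1 : ℝ) / 3)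
      ≤ 4 * (n ^ (-(2 : ℝ) / 3 + ω) * e ^ (-(1 : ℝ) / 3)) *
          (3 * d ^ ((1 : ℝ) / 3) * e ^ ((1 : ℝ) / 3)) := by gcongr
    _ = n ^ (-(2 : ℝ) / 3) * ((12 * n ^ ω) * d ^ ((1 : ℝ) / 3)) *
          (e ^ (-(1 : ℝ) / 3) * e ^ ((1 : ℝ) / 3)) := by
        rw [Real.rpow_add hn]
        ring
    _ ≤ n ^ (-(2 : ℝ) / 3) * (d ^ ((2 : ℝ) / 3) * d ^ ((1 : ℝ) / 3)) *
          (e ^ (-(1 : ℝ) / 3) * e ^ ((1 : ℝ) / 3)) := by gcongr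
    _ = n ^ (-(2 : ℝ) / 3) * d := by rw [hcancel, hdd, mul_one]

lemma one_div_sq_le_of_gap {n d e M g : ℝ} (hn : 0 < n) (he : 1 ≤ e) (hd : 1 ≤ d)
    (hM0 : 0 < M) (hM : M ≤ 3 * d * e)
    (hg : n ^ (-(2 : ℝ) / 3) * d ≤ 2 * |g| * M ^ ((1 : ℝ) / 3)) :
    1 / g ^ 2 ≤ 12 * n ^ ((4 : ℝ) / 3) * e ^ ((2 : ℝ) / 3) * d ^ (-((4 : ℝ) / 3)) := by
  have he0 : 0 < e := by linarith
  have hd0 : 0 < d := by linarith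
  have h3 : (3 : ℝ) ^ ((2 : ℝ) / 3) ≤ 3 := by
    simpa using Real.rpow_le_rpow_of_exponent_le (x := 3) (by norm_num)
      (show (2 : ℝ) / 3 ≤ 1 by norm_num)
  have hpos : 0 < n ^ (-(2 : ℝ) / 3) * d := by positivity
  have hMpos : 0 < M ^ ((1 : ℝ) / 3) := by positivity
  have hg0 : 0 < |g| := by
    by_contra! h
    nlinarith
  have hM2 : (M ^ ((1 : ℝ) / 3)) ^ 2 ≤ 3 * d ^ ((2 : ℝ) / 3) * e ^ ((2 : ℝ) / 3) := by
    calc (M ^ ((1 : ℝ) / 3)) ^ 2 = M ^ ((2 : ℝ) / 3) := by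
          rw [← Real.rpow_natCast, ← Real.rpow_mul hM0.le]
          norm_num
      _ ≤ (3 * d * e) ^ ((2 : ℝ) / 3) := by gcongr
      _ = 3 ^ ((2 : ℝ) / 3) * d ^ ((2 : ℝ) / 3) * e ^ ((2 : ℝ) / 3) := by
        rw [Real.mul_rpow (by positivity) he0.le, Real.mul_rpow (by norm_num) hd0.le]
      _ ≤ _ := by gcongr
  have hn2 : n ^ ((4 : ℝ) / 3) * (n ^ (-(2 : ℝ) / 3)) ^ 2 = 1 := by
    rw [← Real.rpow_natCast, ← Real.rpow_mul hn.le, ← Real.rpow_add hn]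
    norm_num
  have hd2 : d ^ ((2 : ℝ) / 3) = d ^ (-((4 : ℝ) / 3)) * d ^ 2 := by
    rw [← Real.rpow_natCast, ← Real.rpow_add hd0]
    norm_num
  have hsq : (n ^ (-(2 : ℝ) / 3)) ^ 2 * d ^ 2 ≤ 4 * g ^ 2 * (M ^ ((1 : ℝ) / 3)) ^ 2 := by
    have := pow_le_pow_left₀ hpos.le hg 2
    rw [mul_pow, mul_pow, mul_pow, sq_abs] at this
    linarith
  have hg2 : 0 < g ^ 2 := by rw [← sq_abs]; positivity
  rw [div_le_iff₀ hg2]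
  have hfin : (n ^ (-(2 : ℝ) / 3)) ^ 2 * d ^ 2 ≤ (n ^ (-(2 : ℝ) / 3)) ^ 2 * d ^ 2 *
      (12 * n ^ ((4 : ℝ) / 3) * e ^ ((2 : ℝ) / 3) * d ^ (-((4 : ℝ) / 3)) * g ^ 2) := by
    calc (n ^ (-(2 : ℝ) / 3)) ^ 2 * d ^ 2 ≤ 4 * g ^ 2 * (M ^ ((1 : ℝ) / 3)) ^ 2 := hsq
      _ ≤ 4 * g ^ 2 * (3 * d ^ ((2 : ℝ) / 3) * e ^ ((2 : ℝ) / 3)) := by gcongr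
      _ = (n ^ ((4 : ℝ) / 3) * (n ^ (-(2 : ℝ) / 3)) ^ 2) *
          (4 * g ^ 2 * (3 * d ^ ((2 : ℝ) / 3) * e ^ ((2 : ℝ) / 3))) := by rw [hn2, one_mul]
      _ = _ := by rw [hd2]; ring
  exact le_of_mul_le_mul_left (by simpa using hfin) (by positivity : 0 <
    (n ^ (-(2 : ℝ) / 3)) ^ 2 * d ^ 2)

lemma sum_abs_sub_rpow_le {N : ℕ} (s : Finset (Fin N)) (l : Fin N) {b : ℝ} (hb : 1 < b) :
    ∑ p ∈ s, |(p.1 : ℝ) - l.1| ^ (-b) ≤ ∑' m : ℤ, |(m : ℝ)| ^ (-b) := by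
  have hinj : Function.Injective (fun p : Fin N => (p.1 : ℤ) - l.1) := by
    intro p q h
    ext
    simpa using h
  have h := (Real.summable_abs_int_rpow hb).sum_le_tsum (s.map ⟨_, hinj⟩)
    (fun _ _ => by positivity)
  simpa using h

/-- **A deterministic rigidity consequence** (Lemma 4.7). If the `λ_k` satisfy the
rigidity estimate `|λ_k - γ_k| ≤ N^{-2/3+ω} k̂^{-1/3}`, then for every `ℓ`,
`∑_{p : |p-ℓ| > N^{2ω}} (λ_p - λ_ℓ)^{-2} ≤ C' N^{4/3+2ω} ℓ̂^{2/3}` for `N` large. -/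
theorem statement10 (ω : ℝ) (hω : 0 < ω) :
    ∃ C' : ℝ, 0 < C' ∧ ∃ N₀ : ℕ, ∀ N ≥ N₀, ∀ γ lam : Fin N → ℝ,
      IsClassicalLoc N γ → Monotone lam →
      (∀ k : Fin N, |lam k - γ k| ≤
        (N : ℝ) ^ (-(2 : ℝ) / 3 + ω) * (min (k.1 + 1) (N - k.1) : ℝ) ^ (-(1 : ℝ) / 3)) →
      ∀ ℓ : Fin N,
        (∑ p ∈ Finset.univ.filter (fun p : Fin N => (N : ℝ) ^ (2 * ω) < |(p.1 : ℝ) - (ℓ.1 : ℝ)|),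
            1 / (lam p - lam ℓ) ^ 2)
          ≤ C' * (N : ℝ) ^ ((4 : ℝ) / 3 + 2 * ω) * (min (ℓ.1 + 1) (N - ℓ.1) : ℝ) ^ ((2 : ℝ) / 3) := by
  refine ⟨12 * (∑' m : ℤ, |(m : ℝ)| ^ (-((4 : ℝ) / 3)) + 1), by positivity, ?_⟩
  have hev : ∀ᶠ N : ℕ in Filter.atTop, 12 ≤ (N : ℝ) ^ (ω / 3) :=
    ((tendsto_rpow_atTop (by positivity : 0 < ω / 3)).comp
      tendsto_natCast_atTop_atTop).eventually_ge_atTop 12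
  obtain ⟨N₀, hN₀⟩ := Filter.eventually_atTop.1 hev
  refine ⟨N₀, fun N hN γ lam hγ _ hrig ℓ => ?_⟩
  have hbig := hN₀ N hN
  have hNpos : (0 : ℝ) < N := by exact_mod_cast ℓ.pos
  have hN1 : (1 : ℝ) ≤ N := by exact_mod_cast ℓ.pos
  have hterm : ∀ p ∈ Finset.univ.filter
      (fun p : Fin N => (N : ℝ) ^ (2 * ω) < |(p.1 : ℝ) - (ℓ.1 : ℝ)|),
      1 / (lam p - lam ℓ) ^ 2 ≤ 12 * (N : ℝ) ^ ((4 : ℝ) / 3) * edgeDist ℓ ^ ((2 : ℝ) / 3) *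
        |(p.1 : ℝ) - ℓ.1| ^ (-((4 : ℝ) / 3)) := by
    intro p hp
    have hnd := (Finset.mem_filter.1 hp).2
    have hd1 : 1 ≤ |(p.1 : ℝ) - ℓ.1| :=
      (Real.one_le_rpow hN1 (by positivity)).trans hnd.le
    have hne : p ≠ ℓ := by
      rintro rfl
      norm_num at hd1
    have hep := one_le_edgeDist p
    have hel := one_le_edgeDist ℓ
    have hpl := edgeDist_le_add p ℓ
    have hlp := edgeDist_le_add ℓ p
    rw [abs_sub_comm] at hlp
    have hrp := hrig p
    have hrl := hrig ℓ
    change _ ≤ _ * edgeDist p ^ _ at hrp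
    change _ ≤ _ * edgeDist ℓ ^ _ at hrl
    set d := |(p.1 : ℝ) - ℓ.1| with hd
    set M := max (edgeDist p) (edgeDist ℓ) + d with hM
    have hM0 : 0 < M := by linarith [le_max_left (edgeDist p) (edgeDist ℓ)]
    have hMp : M ≤ 3 * d * edgeDist p := by
      have : max (edgeDist p) (edgeDist ℓ) ≤ edgeDist p + d := max_le (by linarith) hlp
      nlinarith [mul_nonneg (sub_nonneg.2 hd1) (sub_nonneg.2 hep)]
    have hMl : M ≤ 3 * d * edgeDist ℓ := by
      have : max (edgeDist p) (edgeDist ℓ) ≤ edgeDist ℓ + d := max_le hpl (by linarith)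
      nlinarith [mul_nonneg (sub_nonneg.2 hd1) (sub_nonneg.2 hel)]
    have hgap := hγ.le_abs_sub hne (M := M)
      (by linarith [le_max_left (edgeDist p) (edgeDist ℓ)])
      (by linarith [le_max_right (edgeDist p) (edgeDist ℓ)])
    have herrp := rigidity_error_le hNpos hep hbig hd1 hnd.le hM0.le hMp
    have herrl := rigidity_error_le hNpos hel hbig hd1 hnd.le hM0.le hMl
    refine one_div_sq_le_of_gap hNpos hel hd1 hM0 hMl ?_
    have htri : |γ p - γ ℓ| ≤ |lam p - lam ℓ| + |lam p - γ p| + |lam ℓ - γ ℓ| := by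
      have h1 := abs_sub_le (γ p) (lam p) (γ ℓ)
      have h2 := abs_sub_le (lam p) (lam ℓ) (γ ℓ)
      rw [abs_sub_comm (γ p) (lam p)] at h1
      linarith
    have hMr : 0 < M ^ ((1 : ℝ) / 3) := by positivity
    have := mul_le_mul_of_nonneg_right (htri.trans (add_le_add (add_le_add_right hrp _) hrl))
      hMr.le
    linarith
  have hel0 : 0 < edgeDist ℓ := by linarith [one_le_edgeDist ℓ]
  change _ ≤ _ * _ * edgeDist ℓ ^ _
  refine (Finset.sum_le_sum hterm).trans ?_
  rw [← Finset.mul_sum]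
  have hs := sum_abs_sub_rpow_le (Finset.univ.filter
    (fun p : Fin N => (N : ℝ) ^ (2 * ω) < |(p.1 : ℝ) - (ℓ.1 : ℝ)|)) ℓ
    (show (1 : ℝ) < 4 / 3 by norm_num)
  have hpw : (N : ℝ) ^ ((4 : ℝ) / 3) ≤ (N : ℝ) ^ ((4 : ℝ) / 3 + 2 * ω) :=
    Real.rpow_le_rpow_of_exponent_le hN1 (by linarith)
  calc _ ≤ 12 * (N : ℝ) ^ ((4 : ℝ) / 3 + 2 * ω) * edgeDist ℓ ^ ((2 : ℝ) / 3) *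
        (∑' m : ℤ, |(m : ℝ)| ^ (-((4 : ℝ) / 3)) + 1) := by
        gcongr
        linarith
    _ = _ := by ring
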